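/- arXiv:2110.14047 — 2 statements merged into one kernel-verified Lean document; each statement's English description precedes it below -/
import Mathlib

section
/- Strong duality for the shape distance programs: Fix T > 0, compact sets Ω ⊆ ℝ^{N_ω}, Ω₀ ⊆ Ω, S ⊆ ℝ^{N_s}, X ⊆ ℝⁿ, X_u ⊆ X, a continuous map A : S × Ω → X, a function f : ℝ × ℝ^{N_ω} → ℝ^{N_ω} Lipschitz in each argument, and a continuous cost c on X × X_u; assume the non-return properties for the orientation state (if ω(t | ω₀) touches ∂Ω it does not return to Ω on (t,T]) and for the shape image (if A(s; ω(t|ω₀)) leaves X or touches ∂X for some s ∈ S, then it does not return to X on (t,T]). Then the shape measure program and the shape function program are strongly dual: the infimum of ∫ c dη over shape-feasible measure tuples equals the supremum of γ over shape-dual-feasible quadruples (γ, v, w, z). -/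
open MeasureTheory Set

noncomputable section

/-- `ℝⁿ` -/
abbrev Vec (n : ℕ) : Type := EuclideanSpace ℝ (Fin n)

/-- Lie derivative of `v` along the vector field `f`. -/
def LieD {n : ℕ} (f : ℝ × Vec n → Vec n) (v : ℝ × Vec n → ℝ) (p : ℝ × Vec n) : ℝ :=
  fderiv ℝ v p ((1 : ℝ), f p)

/-- A shape-feasible measure tuple `(μ₀, μ_p, μ, μ_s, η)` for the shape
distance-estimation measure program: finite nonnegative Borel measures supported on
`Ω₀`, `[0,T] × Ω`, `[0,T] × Ω`, `S × Ω` and `X × X_u` respectively, with `μ₀` a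
probability measure, satisfying Liouville's equation, the `ω`-marginal matching
between `μ_p` and `μ_s`, and the matching of the `x`-marginal of `η` with the
pushforward of `μ_s` under `A`. -/
def ShapeFeasible {nw ns n : ℕ} (T : ℝ) (Om Om0 : Set (Vec nw)) (S : Set (Vec ns))
    (X Xu : Set (Vec n)) (A : Vec ns × Vec nw → Vec n) (f : ℝ × Vec nw → Vec nw)
    (μ0 : Measure (Vec nw)) (μp μ : Measure (ℝ × Vec nw))
    (μs : Measure (Vec ns × Vec nw)) (η : Measure (Vec n × Vec n)) : Prop :=
  IsFiniteMeasure μ0 ∧ IsFiniteMeasure μp ∧ IsFiniteMeasure μ ∧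
  IsFiniteMeasure μs ∧ IsFiniteMeasure η ∧
  μ0 Om0ᶜ = 0 ∧ μp ((Icc 0 T ×ˢ Om)ᶜ) = 0 ∧ μ ((Icc 0 T ×ˢ Om)ᶜ) = 0 ∧
  μs ((S ×ˢ Om)ᶜ) = 0 ∧ η ((X ×ˢ Xu)ᶜ) = 0 ∧ μ0 Om0 = 1 ∧
  (∀ v : ℝ × Vec nw → ℝ, ContDiff ℝ 1 v →
    (∫ z, v z ∂μp) = (∫ w, v (0, w) ∂μ0) + ∫ z, LieD f v z ∂μ) ∧
  (∀ z : Vec nw → ℝ, Continuous z → (∫ p, z p.2 ∂μp) = ∫ q, z q.2 ∂μs) ∧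
  (∀ w : Vec n → ℝ, Continuous w → (∫ p, w p.1 ∂η) = ∫ q, w (A q) ∂μs)


/-- A shape-dual-feasible quadruple `(γ, v, w, z)` for the shape distance function
program. -/
def ShapeDualFeasible {nw ns n : ℕ} (T : ℝ) (Om Om0 : Set (Vec nw)) (S : Set (Vec ns))
    (X Xu : Set (Vec n)) (A : Vec ns × Vec nw → Vec n) (f : ℝ × Vec nw → Vec nw)
    (c : Vec n × Vec n → ℝ)
    (γ : ℝ) (v : ℝ × Vec nw → ℝ) (w : Vec n → ℝ) (z : Vec nw → ℝ) : Prop :=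
  ContDiff ℝ 1 v ∧ Continuous w ∧ Continuous z ∧
  (∀ om ∈ Om0, γ ≤ v (0, om)) ∧
  (∀ x ∈ X, ∀ y ∈ Xu, w x ≤ c (x, y)) ∧
  (∀ s ∈ S, ∀ om ∈ Om, z om ≤ w (A (s, om))) ∧
  (∀ t ∈ Icc 0 T, ∀ om ∈ Om, v (t, om) ≤ z om) ∧
  (∀ t ∈ Icc 0 T, ∀ om ∈ Om, 0 ≤ LieD f v (t, om))

/-- If a range of affine translates misses a nonempty open convex cone, some nonzero functional is
nonnegative on the cone, vanishes on the linear part and is nonpositive at the base point. -/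
theorem exists_dual_of_forall_add_notMem_cone {V Y : Type*} [AddCommGroup V] [Module ℝ V]
    [AddCommGroup Y] [TopologicalSpace Y] [IsTopologicalAddGroup Y] [Module ℝ Y]
    [ContinuousSMul ℝ Y] {P : Set Y} (hPo : IsOpen P) (hPc : Convex ℝ P)
    (hPs : ∀ t : ℝ, 0 < t → ∀ p ∈ P, t • p ∈ P) (hPn : P.Nonempty)
    (L : V →ₗ[ℝ] Y) (y₀ : Y) (hL : ∀ l, y₀ + L l ∉ P) :
    ∃ φ : Y →L[ℝ] ℝ, φ ≠ 0 ∧ (∀ p ∈ P, 0 ≤ φ p) ∧ (∀ l, φ (L l) = 0) ∧ φ y₀ ≤ 0 := by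
  have hconv : Convex ℝ (range fun l => y₀ + L l) := by
    rintro _ ⟨a, rfl⟩ _ ⟨b, rfl⟩ s t _ _ hst
    refine ⟨s • a + t • b, ?_⟩
    have : y₀ = s • y₀ + t • y₀ := by rw [← add_smul, hst, one_smul]
    simp only [map_add, map_smul, smul_add]
    nth_rewrite 1 [this]
    abel
  obtain ⟨g, u, hgP, hgL⟩ := geometric_hahn_banach_open hPc hPo hconv <| by
    rw [Set.disjoint_left]
    rintro _ hp ⟨l, rfl⟩
    exact hL l hp
  obtain ⟨p₀, hp₀⟩ := hPn
  have hgL' : ∀ l, u ≤ g y₀ + g (L l) := fun l => by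
    simpa using hgL _ ⟨l, rfl⟩
  have hu : 0 ≤ u := by
    by_contra! hu
    have h1 := hgP p₀ hp₀
    have hneg : g p₀ < 0 := h1.trans hu
    have h2 := hgP _ (hPs (u / (2 * g p₀)) (div_pos_of_neg_of_neg hu (by linarith)) p₀ hp₀)
    rw [map_smul, smul_eq_mul] at h2
    have : u / (2 * g p₀) * g p₀ = u / 2 := by
      have := hneg.ne
      field_simp
    linarith
  have hle : ∀ p ∈ P, g p ≤ 0 := by
    intro p hp
    by_contra! hpos
    have h2 := hgP _ (hPs ((u + 1) / g p) (by positivity) p hp)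
    rw [map_smul, smul_eq_mul, div_mul_cancel₀ _ hpos.ne'] at h2
    linarith
  have hzero : ∀ l, g (L l) = 0 := by
    intro l
    by_contra hne
    have h2 := hgL' (((u - 1 - g y₀) / g (L l)) • l)
    rw [map_smul, map_smul, smul_eq_mul, div_mul_cancel₀ _ hne] at h2
    linarith
  refine ⟨-g, ?_, ?_, ?_, ?_⟩
  · intro h
    have hg : g = 0 := neg_eq_zero.mp h
    have h1 := hgP p₀ hp₀
    have h2 := hgL' 0
    simp [hg] at h1 h2
    linarith
  · intro p hp
    simpa using hle p hp
  · intro l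
    simpa using hzero l
  · have h2 := hgL' 0
    simp at h2
    simp
    linarith

/-- Riesz representation of a positive functional on `C(K, ℝ)` by a measure on the ambient space
concentrated on the compact set `K`. -/
theorem exists_measure_of_nonneg_functional {E : Type*} [TopologicalSpace E] [T2Space E]
    [MeasurableSpace E] [BorelSpace E] {K : Set E} (hK : IsCompact K)
    (Λ : C(K, ℝ) →ₗ[ℝ] ℝ) (hΛ : ∀ g, 0 ≤ g → 0 ≤ Λ g) :
    ∃ μ : Measure E, IsFiniteMeasure μ ∧ μ Kᶜ = 0 ∧ (μ = 0 → Λ = 0) ∧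
      ∀ (g : C(K, ℝ)) (g' : E → ℝ), (∀ x : K, g x = g' x) → Λ g = ∫ x, g' x ∂μ := by
  have : CompactSpace K := isCompact_iff_compactSpace.mp hK
  let Λ' : CompactlySupportedContinuousMap K ℝ →ₚ[ℝ] ℝ := PositiveLinearMap.mk₀
    { toFun := fun g => Λ g.toContinuousMap
      map_add' := fun a b => Λ.map_add a.toContinuousMap b.toContinuousMap
      map_smul' := fun r a => Λ.map_smul r a.toContinuousMap }
    (fun g hg => hΛ _ hg)
  let ν := RealRMK.rieszMeasure Λ'
  have hν : ∀ g : C(K, ℝ), Λ g = ∫ x, g x ∂ν := fun g =>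
    (RealRMK.integral_rieszMeasure Λ'
      (CompactlySupportedContinuousMap.continuousMapEquiv g)).symm
  have hme : MeasurableEmbedding (Subtype.val : K → E) :=
    MeasurableEmbedding.subtype_coe hK.measurableSet
  refine ⟨ν.map Subtype.val, inferInstance, ?_, ?_, ?_⟩
  · rw [hme.map_apply]
    simp
  · intro h
    have h0 : ν = 0 := (Measure.map_eq_zero_iff hme.measurable.aemeasurable).mp h
    ext g
    simp [hν, h0]
  · intro g g' h
    rw [hme.integral_map, hν]
    simp [h]

theorem isOpen_setOf_forall_pos {K : Type*} [TopologicalSpace K] [CompactSpace K] :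
    IsOpen {g : C(K, ℝ) | ∀ x, 0 < g x} := by
  have := ContinuousMap.isOpen_setOfPred_mapsTo (X := K) (Y := ℝ) isCompact_univ
    (isOpen_Ioi (a := (0 : ℝ)))
  simpa [MapsTo] using this

theorem convex_setOf_forall_pos {K : Type*} [TopologicalSpace K] :
    Convex ℝ {g : C(K, ℝ) | ∀ x, 0 < g x} := by
  intro a ha b hb s t hs ht hst x
  exact convex_Ioi (0 : ℝ) (ha x) (hb x) hs ht hst

theorem ContinuousOn.integrable_of_measure_compl_eq_zero {E : Type*} [TopologicalSpace E]
    [T2Space E] [MeasurableSpace E] [BorelSpace E] {K : Set E} (hK : IsCompact K) {μ : Measure E}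
    [IsFiniteMeasure μ] (hμ : μ Kᶜ = 0) {g : E → ℝ} (hg : ContinuousOn g K) :
    Integrable g μ := by
  have : μ.restrict K = μ := Measure.restrict_eq_self_of_ae_mem (mem_ae_iff.mpr hμ)
  rw [← this]
  exact hg.integrableOn_compact hK

theorem integral_mono_of_measure_compl_eq_zero {E : Type*} [TopologicalSpace E]
    [T2Space E] [MeasurableSpace E] [BorelSpace E] {K : Set E} (hK : IsCompact K) {μ : Measure E}
    [IsFiniteMeasure μ] (hμ : μ Kᶜ = 0) {g h : E → ℝ} (hg : ContinuousOn g K)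
    (hh : ContinuousOn h K) (hgh : ∀ x ∈ K, g x ≤ h x) : ∫ x, g x ∂μ ≤ ∫ x, h x ∂μ := by
  refine integral_mono_ae (hg.integrable_of_measure_compl_eq_zero hK hμ)
    (hh.integrable_of_measure_compl_eq_zero hK hμ) ?_
  have : ∀ᵐ x ∂μ, x ∈ K := mem_ae_iff.mpr hμ
  filter_upwards [this] with x hx using hgh x hx

theorem continuous_LieD {n : ℕ} {f : ℝ × Vec n → Vec n} (hf : Continuous f)
    {v : ℝ × Vec n → ℝ} (hv : ContDiff ℝ 1 v) : Continuous (LieD f v) :=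
  (hv.continuous_fderiv one_ne_zero).clm_apply (continuous_const.prodMk hf)

theorem LieD_add {n : ℕ} (f : ℝ × Vec n → Vec n) {v w : ℝ × Vec n → ℝ}
    (hv : ContDiff ℝ 1 v) (hw : ContDiff ℝ 1 w) (p : ℝ × Vec n) :
    LieD f (v + w) p = LieD f v p + LieD f w p := by
  simp [LieD, fderiv_add (hv.differentiable one_ne_zero p) (hw.differentiable one_ne_zero p)]

theorem LieD_smul {n : ℕ} (f : ℝ × Vec n → Vec n) (r : ℝ) {v : ℝ × Vec n → ℝ}
    (hv : ContDiff ℝ 1 v) (p : ℝ × Vec n) :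
    LieD f (r • v) p = r * LieD f v p := by
  simp [LieD, fderiv_const_smul (hv.differentiable one_ne_zero p)]

theorem LieD_const {n : ℕ} (f : ℝ × Vec n → Vec n) (a : ℝ) (p : ℝ × Vec n) :
    LieD f (fun _ => a) p = 0 := by
  simp [LieD]

theorem LieD_fst {n : ℕ} (f : ℝ × Vec n → Vec n) (p : ℝ × Vec n) :
    LieD f Prod.fst p = 1 := by
  simp [LieD, fderiv_fst]

/-- Every dual-feasible value is at most every primal-feasible value. -/
theorem weak_duality {nw ns n : ℕ} {T : ℝ}
    {Om Om0 : Set (Vec nw)} {S : Set (Vec ns)} {X Xu : Set (Vec n)}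
    (hOm : IsCompact Om) (hOm0 : IsCompact Om0) (hS : IsCompact S)
    (hX : IsCompact X) (hXu : IsCompact Xu)
    {A : Vec ns × Vec nw → Vec n} (hA : Continuous A)
    {f : ℝ × Vec nw → Vec nw} (hf : Continuous f)
    {c : Vec n × Vec n → ℝ} (hc : ContinuousOn c (X ×ˢ Xu))
    {μ0 : Measure (Vec nw)} {μp μ : Measure (ℝ × Vec nw)}
    {μs : Measure (Vec ns × Vec nw)} {η : Measure (Vec n × Vec n)}
    (hP : ShapeFeasible T Om Om0 S X Xu A f μ0 μp μ μs η)
    {γ : ℝ} {v : ℝ × Vec nw → ℝ} {w : Vec n → ℝ} {z : Vec nw → ℝ}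
    (hD : ShapeDualFeasible T Om Om0 S X Xu A f c γ v w z) : γ ≤ ∫ p, c p ∂η := by
  obtain ⟨h0, hp, hm, hs, he, s0, sp, sm, ss, se, m0, hLiou, hz, hw⟩ := hP
  obtain ⟨cv, cw, cz, d0, d1, d2, d3, d4⟩ := hD
  have hK : IsCompact (Icc 0 T ×ˢ Om) := isCompact_Icc.prod hOm
  have hmass : μ0.real univ = 1 := by
    have : μ0 univ = 1 := by
      rw [← m0, ← measure_add_measure_compl hOm0.measurableSet, s0, add_zero]
    simp [Measure.real, this]
  have e0 : γ ≤ ∫ w, v (0, w) ∂μ0 := by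
    have := integral_mono_of_measure_compl_eq_zero hOm0 s0 (g := fun _ => γ) (h := fun w => v (0, w))
      continuousOn_const (by have := cv.continuous; fun_prop) d0
    simpa [hmass] using this
  have e1 : 0 ≤ ∫ z, LieD f v z ∂μ := by
    have := integral_mono_of_measure_compl_eq_zero hK sm (g := fun _ => 0) (h := LieD f v)
      continuousOn_const (continuous_LieD hf cv).continuousOn (fun x hx => d4 _ hx.1 _ hx.2)
    simpa using this
  have e2 : ∫ p, v p ∂μp ≤ ∫ p, z p.2 ∂μp :=
    integral_mono_of_measure_compl_eq_zero hK sp cv.continuous.continuousOn (by fun_prop)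
      (fun x hx => d3 _ hx.1 _ hx.2)
  have e3 : ∫ q, z q.2 ∂μs ≤ ∫ q, w (A q) ∂μs :=
    integral_mono_of_measure_compl_eq_zero (hS.prod hOm) ss (by fun_prop) (by fun_prop)
      (fun x hx => d2 _ hx.1 _ hx.2)
  have e4 : ∫ p, w p.1 ∂η ≤ ∫ p, c p ∂η :=
    integral_mono_of_measure_compl_eq_zero (hX.prod hXu) se (by fun_prop) hc
      (fun x hx => d1 _ hx.1 _ hx.2)
  linarith [hLiou v cv, hz z cz, hw w cw]

/-- The continuously differentiable functions, as a space of test functions. -/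
def contDiffOneSubmodule (E : Type*) [NormedAddCommGroup E] [NormedSpace ℝ E] :
    Submodule ℝ (E → ℝ) where
  carrier := {v | ContDiff ℝ 1 v}
  add_mem' := fun {a b} (ha : ContDiff ℝ 1 a) (hb : ContDiff ℝ 1 b) =>
    show ContDiff ℝ 1 (a + b) from ha.add hb
  zero_mem' := show ContDiff ℝ 1 (fun _ => (0 : ℝ)) from contDiff_const
  smul_mem' := fun r a (ha : ContDiff ℝ 1 a) =>
    show ContDiff ℝ 1 (r • a) from ha.const_smul r

theorem contDiff_coe_contDiffOneSubmodule {E : Type*} [NormedAddCommGroup E] [NormedSpace ℝ E]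
    (v : contDiffOneSubmodule E) : ContDiff ℝ 1 v.1 :=
  v.2

/-- A tuple of finite measures satisfying the homogeneous constraints of the shape measure program,
with `μ0` nonzero, can be normalized to a feasible one. -/
theorem exists_shapeFeasible_of_ne_zero {nw ns n : ℕ} {T : ℝ}
    {Om Om0 : Set (Vec nw)} {S : Set (Vec ns)} {X Xu : Set (Vec n)} (hOm0 : IsCompact Om0)
    {A : Vec ns × Vec nw → Vec n} {f : ℝ × Vec nw → Vec nw}
    {μ0 : Measure (Vec nw)} {μp μ : Measure (ℝ × Vec nw)}
    {μs : Measure (Vec ns × Vec nw)} {η : Measure (Vec n × Vec n)}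
    [IsFiniteMeasure μ0] [IsFiniteMeasure μp] [IsFiniteMeasure μ]
    [IsFiniteMeasure μs] [IsFiniteMeasure η]
    (s0 : μ0 Om0ᶜ = 0) (sp : μp ((Icc 0 T ×ˢ Om)ᶜ) = 0) (sm : μ ((Icc 0 T ×ˢ Om)ᶜ) = 0)
    (ss : μs ((S ×ˢ Om)ᶜ) = 0) (se : η ((X ×ˢ Xu)ᶜ) = 0) (hne : μ0 ≠ 0)
    (hv : ∀ v : ℝ × Vec nw → ℝ, ContDiff ℝ 1 v →
      (∫ z, v z ∂μp) = (∫ w, v (0, w) ∂μ0) + ∫ z, LieD f v z ∂μ)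
    (hz : ∀ z : Vec nw → ℝ, Continuous z → (∫ p, z p.2 ∂μp) = ∫ q, z q.2 ∂μs)
    (hw : ∀ w : Vec n → ℝ, Continuous w → (∫ p, w p.1 ∂η) = ∫ q, w (A q) ∂μs) :
    ∃ r : ENNReal, 0 < r.toReal ∧
      ShapeFeasible T Om Om0 S X Xu A f (r • μ0) (r • μp) (r • μ) (r • μs) (r • η) := by
  have hu : μ0 univ ≠ 0 := by simpa using hne
  have hu' : μ0 univ ≠ ⊤ := measure_ne_top _ _
  have hr : (μ0 univ)⁻¹ ≠ ⊤ := ENNReal.inv_ne_top.mpr hu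
  have hm : μ0 Om0 = μ0 univ := by
    rw [← measure_add_measure_compl hOm0.measurableSet, s0, add_zero]
  refine ⟨(μ0 univ)⁻¹, ENNReal.toReal_pos (ENNReal.inv_ne_zero.mpr hu') hr,
    Measure.smul_finite _ hr, Measure.smul_finite _ hr, Measure.smul_finite _ hr,
    Measure.smul_finite _ hr, Measure.smul_finite _ hr,
    by simp [s0], by simp [sp], by simp [sm], by simp [ss], by simp [se], ?_, ?_, ?_, ?_⟩
  · simp [hm, ENNReal.inv_mul_cancel hu hu']
  · intro v h
    simp only [integral_smul_measure, hv v h, smul_add]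
  · intro z h
    simp only [integral_smul_measure, hz z h]
  · intro w h
    simp only [integral_smul_measure, hw w h]

theorem eq_zero_of_integral_one_eq_zero {E : Type*} [MeasurableSpace E] {μ : Measure E}
    [IsFiniteMeasure μ] (h : ∫ _, (1 : ℝ) ∂μ = 0) : μ = 0 := by
  simpa [Measure.real, ENNReal.toReal_eq_zero_iff] using h

/-- A value that is not dual-feasible is bounded below by a primal-feasible one. -/
theorem exists_shapeFeasible_integral_le {nw ns n : ℕ} {T : ℝ}
    {Om Om0 : Set (Vec nw)} {S : Set (Vec ns)} {X Xu : Set (Vec n)}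
    (hOm : IsCompact Om) (hOm0 : IsCompact Om0) (hS : IsCompact S)
    (hX : IsCompact X) (hXu : IsCompact Xu)
    {A : Vec ns × Vec nw → Vec n} (hA : Continuous A)
    {f : ℝ × Vec nw → Vec nw} (hf : Continuous f)
    {c : Vec n × Vec n → ℝ} (hc : ContinuousOn c (X ×ˢ Xu)) {γ : ℝ}
    (hγ : ¬ ∃ v w z, ShapeDualFeasible T Om Om0 S X Xu A f c γ v w z) :
    ∃ μ0 μp μ μs η, ShapeFeasible T Om Om0 S X Xu A f μ0 μp μ μs η ∧ ∫ p, c p ∂η ≤ γ := by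
  have hK : IsCompact (Icc 0 T ×ˢ Om) := isCompact_Icc.prod hOm
  have : CompactSpace Om0 := isCompact_iff_compactSpace.mp hOm0
  have : CompactSpace ↑(Icc 0 T ×ˢ Om) := isCompact_iff_compactSpace.mp hK
  have : CompactSpace ↑(S ×ˢ Om) := isCompact_iff_compactSpace.mp (hS.prod hOm)
  have : CompactSpace ↑(X ×ˢ Xu) := isCompact_iff_compactSpace.mp (hX.prod hXu)
  let P : Set (C(Om0, ℝ) × C(↑(Icc 0 T ×ˢ Om), ℝ) × C(↑(Icc 0 T ×ˢ Om), ℝ) ×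
      C(↑(S ×ˢ Om), ℝ) × C(↑(X ×ˢ Xu), ℝ)) :=
    {g | ∀ x, 0 < g x} ×ˢ {g | ∀ x, 0 < g x} ×ˢ {g | ∀ x, 0 < g x} ×ˢ
      {g | ∀ x, 0 < g x} ×ˢ {g | ∀ x, 0 < g x}
  let L : (contDiffOneSubmodule (ℝ × Vec nw) × C(Vec n, ℝ) × C(Vec nw, ℝ)) →ₗ[ℝ]
      (C(Om0, ℝ) × C(↑(Icc 0 T ×ˢ Om), ℝ) × C(↑(Icc 0 T ×ˢ Om), ℝ) ×
      C(↑(S ×ˢ Om), ℝ) × C(↑(X ×ˢ Xu), ℝ)) :=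
    { toFun := fun l =>
        (⟨fun x => l.1.1 (0, x.1), (contDiff_coe_contDiffOneSubmodule l.1).continuous.comp (by fun_prop)⟩,
         ⟨fun x => LieD f l.1.1 x.1, (continuous_LieD hf (contDiff_coe_contDiffOneSubmodule l.1)).comp (by fun_prop)⟩,
         ⟨fun x => l.2.2 x.1.2 - l.1.1 x.1,
            Continuous.sub (by fun_prop) ((contDiff_coe_contDiffOneSubmodule l.1).continuous.comp (by fun_prop))⟩,
         ⟨fun x => l.2.1 (A x.1) - l.2.2 x.1.2, by fun_prop⟩,
         ⟨fun x => - l.2.1 x.1.1, by fun_prop⟩)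
      map_add' := by
        intro a b
        refine Prod.ext ?_ (Prod.ext ?_ (Prod.ext ?_ (Prod.ext ?_ ?_))) <;> ext x
        · rfl
        · exact LieD_add f a.1.2 b.1.2 x.1
        all_goals simp; ring
      map_smul' := by
        intro r a
        refine Prod.ext ?_ (Prod.ext ?_ (Prod.ext ?_ (Prod.ext ?_ ?_))) <;> ext x
        · rfl
        · exact LieD_smul f r a.1.2 x.1
        all_goals simp; try ring }
  let c' : C(↑(X ×ˢ Xu), ℝ) := ⟨fun x => c x.1, hc.domRestrict⟩
  obtain ⟨φ, hφ, hφP, hφL, hφy⟩ := exists_dual_of_forall_add_notMem_cone (P := P)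
    (isOpen_setOf_forall_pos.prod (isOpen_setOf_forall_pos.prod (isOpen_setOf_forall_pos.prod
      (isOpen_setOf_forall_pos.prod isOpen_setOf_forall_pos))))
    (convex_setOf_forall_pos.prod (convex_setOf_forall_pos.prod (convex_setOf_forall_pos.prod
      (convex_setOf_forall_pos.prod convex_setOf_forall_pos))))
    (fun t ht p hp => ⟨fun x => mul_pos ht (hp.1 x), fun x => mul_pos ht (hp.2.1 x),
      fun x => mul_pos ht (hp.2.2.1 x), fun x => mul_pos ht (hp.2.2.2.1 x),
      fun x => mul_pos ht (hp.2.2.2.2 x)⟩)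
    ⟨1, fun _ => one_pos, fun _ => one_pos, fun _ => one_pos, fun _ => one_pos, fun _ => one_pos⟩
    L (ContinuousMap.const _ (-γ), 0, 0, 0, c') (by
      rintro ⟨v, w, z⟩ ⟨h0, h1, h2, h3, h4⟩
      refine hγ ⟨v.1, w, z, contDiff_coe_contDiffOneSubmodule v, w.continuous, z.continuous, ?_, ?_, ?_, ?_, ?_⟩
      · intro om hom
        have : 0 < -γ + v.1 (0, om) := h0 ⟨om, hom⟩
        linarith
      · intro x hx y hy
        have : 0 < c (x, y) + - w x := h4 ⟨(x, y), hx, hy⟩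
        linarith
      · intro s hs om hom
        have : 0 < 0 + (w (A (s, om)) - z om) := h3 ⟨(s, om), hs, hom⟩
        linarith
      · intro t ht om hom
        have : 0 < 0 + (z om - v.1 (t, om)) := h2 ⟨(t, om), ht, hom⟩
        linarith
      · intro t ht om hom
        have : 0 < 0 + LieD f v.1 (t, om) := h1 ⟨(t, om), ht, hom⟩
        linarith)
  have hφ0 : ∀ y, 0 ≤ y → 0 ≤ φ y := by
    intro y hy
    have key : ∀ ε : ℝ, 0 < ε → 0 ≤ φ y + ε * φ 1 := by
      intro ε hε
      have := hφP (y + ε • 1) ⟨fun x => add_pos_of_nonneg_of_pos (hy.1 x) (mul_pos hε one_pos),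
        fun x => add_pos_of_nonneg_of_pos (hy.2.1 x) (mul_pos hε one_pos),
        fun x => add_pos_of_nonneg_of_pos (hy.2.2.1 x) (mul_pos hε one_pos),
        fun x => add_pos_of_nonneg_of_pos (hy.2.2.2.1 x) (mul_pos hε one_pos),
        fun x => add_pos_of_nonneg_of_pos (hy.2.2.2.2 x) (mul_pos hε one_pos)⟩
      simpa using this
    by_contra! hneg
    have h1 := key 1 one_pos
    have h1pos : 0 < φ 1 := by linarith
    have h2 := key (-φ y / (2 * φ 1)) (div_pos (by linarith) (by linarith))
    have : -φ y / (2 * φ 1) * φ 1 = -φ y / 2 := by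
      have := h1pos.ne'
      field_simp
    linarith
  have hsplit : ∀ a b d e g, φ (a, b, d, e, g) = φ (a, 0, 0, 0, 0) + φ (0, b, 0, 0, 0) +
      φ (0, 0, d, 0, 0) + φ (0, 0, 0, e, 0) + φ (0, 0, 0, 0, g) := by
    intro a b d e g
    simp only [← map_add, Prod.mk_add_mk, add_zero, zero_add]
  obtain ⟨μ0, _, s0, z0, r0⟩ := exists_measure_of_nonneg_functional hOm0
    (φ.toLinearMap ∘ₗ LinearMap.inl ℝ _ _)
    (fun g hg => hφ0 _ ⟨hg, le_rfl, le_rfl, le_rfl, le_rfl⟩)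
  obtain ⟨μ, _, sm, zm, rm⟩ := exists_measure_of_nonneg_functional hK
    (φ.toLinearMap ∘ₗ LinearMap.inr ℝ _ _ ∘ₗ LinearMap.inl ℝ _ _)
    (fun g hg => hφ0 _ ⟨le_rfl, hg, le_rfl, le_rfl, le_rfl⟩)
  obtain ⟨μp, _, sp, zp, rp⟩ := exists_measure_of_nonneg_functional hK
    (φ.toLinearMap ∘ₗ LinearMap.inr ℝ _ _ ∘ₗ LinearMap.inr ℝ _ _ ∘ₗ LinearMap.inl ℝ _ _)
    (fun g hg => hφ0 _ ⟨le_rfl, le_rfl, hg, le_rfl, le_rfl⟩)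
  obtain ⟨μs, _, ss, zs, rs⟩ := exists_measure_of_nonneg_functional (hS.prod hOm)
    (φ.toLinearMap ∘ₗ LinearMap.inr ℝ _ _ ∘ₗ LinearMap.inr ℝ _ _ ∘ₗ LinearMap.inr ℝ _ _ ∘ₗ
      LinearMap.inl ℝ _ _)
    (fun g hg => hφ0 _ ⟨le_rfl, le_rfl, le_rfl, hg, le_rfl⟩)
  obtain ⟨η, _, se, ze, re⟩ := exists_measure_of_nonneg_functional (hX.prod hXu)
    (φ.toLinearMap ∘ₗ LinearMap.inr ℝ _ _ ∘ₗ LinearMap.inr ℝ _ _ ∘ₗ LinearMap.inr ℝ _ _ ∘ₗ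
      LinearMap.inr ℝ _ _)
    (fun g hg => hφ0 _ ⟨le_rfl, le_rfl, le_rfl, le_rfl, hg⟩)
  have hbal : ∀ (v : ℝ × Vec nw → ℝ) (w : C(Vec n, ℝ)) (z : C(Vec nw, ℝ)), ContDiff ℝ 1 v →
      (∫ x, v (0, x) ∂μ0) + (∫ x, LieD f v x ∂μ) + (∫ x, (z x.2 - v x) ∂μp) +
        (∫ x, (w (A x) - z x.2) ∂μs) + (∫ x, - w x.1 ∂η) = 0 := by
    intro v w z hv
    have h := hφL (⟨v, hv⟩, w, z)
    rw [← r0 (L (⟨v, hv⟩, w, z)).1 _ (fun _ => rfl),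
      ← rm (L (⟨v, hv⟩, w, z)).2.1 _ (fun _ => rfl),
      ← rp (L (⟨v, hv⟩, w, z)).2.2.1 _ (fun _ => rfl),
      ← rs (L (⟨v, hv⟩, w, z)).2.2.2.1 _ (fun _ => rfl),
      ← re (L (⟨v, hv⟩, w, z)).2.2.2.2 _ (fun _ => rfl)]
    exact (hsplit _ _ _ _ _).symm.trans h
  have hval : ∫ p, c p ∂η ≤ γ * μ0.real univ := by
    rw [hsplit] at hφy
    have e0 : φ (ContinuousMap.const _ (-γ), 0, 0, 0, 0) = ∫ _, -γ ∂μ0 := r0 _ _ (fun _ => rfl)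
    have e1 : φ (0, 0, 0, 0, c') = ∫ p, c p ∂η := re _ _ (fun _ => rfl)
    have e2 : φ (0, 0, 0, 0, 0) = 0 := map_zero φ
    rw [e0, e1, e2, integral_const, smul_eq_mul] at hφy
    linarith
  have hv : ∀ v : ℝ × Vec nw → ℝ, ContDiff ℝ 1 v →
      (∫ z, v z ∂μp) = (∫ w, v (0, w) ∂μ0) + ∫ z, LieD f v z ∂μ := by
    intro v h
    have := hbal v 0 0 h
    simp [integral_neg] at this
    linarith
  have hz : ∀ z : Vec nw → ℝ, Continuous z → (∫ p, z p.2 ∂μp) = ∫ q, z q.2 ∂μs := by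
    intro z h
    have := hbal (fun _ => 0) 0 ⟨z, h⟩ contDiff_const
    simp [integral_neg, LieD_const] at this
    linarith
  have hw : ∀ w : Vec n → ℝ, Continuous w → (∫ p, w p.1 ∂η) = ∫ q, w (A q) ∂μs := by
    intro w h
    have := hbal (fun _ => 0) ⟨w, h⟩ 0 contDiff_const
    simp [integral_neg, LieD_const] at this
    linarith
  have hne : μ0 ≠ 0 := by
    intro h
    have hp : μp = 0 := eq_zero_of_integral_one_eq_zero <| by
      simpa [h, LieD_const] using hv (fun _ => 1) contDiff_const
    have hm : μ = 0 := eq_zero_of_integral_one_eq_zero <| by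
      simpa only [h, hp, LieD_fst, integral_zero_measure, zero_add, eq_comm] using
        hv Prod.fst contDiff_fst
    have hs : μs = 0 := eq_zero_of_integral_one_eq_zero <| by
      simpa only [hp, integral_zero_measure, eq_comm] using hz (fun _ => 1) continuous_const
    have he : η = 0 := eq_zero_of_integral_one_eq_zero <| by
      simpa only [hs, integral_zero_measure] using hw (fun _ => 1) continuous_const
    refine hφ (ContinuousLinearMap.ext fun ⟨a, b, d, e, g⟩ => ?_)
    have h0 : φ (a, 0, 0, 0, 0) = 0 := LinearMap.congr_fun (z0 h) a
    have h1 : φ (0, b, 0, 0, 0) = 0 := LinearMap.congr_fun (zm hm) b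
    have h2 : φ (0, 0, d, 0, 0) = 0 := LinearMap.congr_fun (zp hp) d
    have h3 : φ (0, 0, 0, e, 0) = 0 := LinearMap.congr_fun (zs hs) e
    have h4 : φ (0, 0, 0, 0, g) = 0 := LinearMap.congr_fun (ze he) g
    rw [hsplit, h0, h1, h2, h3, h4]
    simp
  obtain ⟨r, hr, hfeas⟩ := exists_shapeFeasible_of_ne_zero hOm0 s0 sp sm ss se hne hv hz hw
  refine ⟨_, _, _, _, _, hfeas, ?_⟩
  have hone : r.toReal * μ0.real univ = 1 := by
    have h1 : (r • μ0) Om0 = 1 := hfeas.2.2.2.2.2.2.2.2.2.2.1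
    have hm : μ0 Om0 = μ0 univ := by
      rw [← measure_add_measure_compl hOm0.measurableSet, s0, add_zero]
    rw [Measure.smul_apply, smul_eq_mul, hm] at h1
    rw [Measure.real, ← ENNReal.toReal_mul, h1, ENNReal.toReal_one]
  rw [integral_smul_measure, smul_eq_mul]
  calc r.toReal * ∫ p, c p ∂η ≤ r.toReal * (γ * μ0.real univ) := by gcongr
    _ = γ * (r.toReal * μ0.real univ) := by ring
    _ = γ := by rw [hone, mul_one]

/-- Two sets of reals, one lying below the other and together leaving no gap, have matching
supremum and infimum. -/
theorem sInf_eq_sSup_of_no_gap {P D : Set ℝ} (hle : ∀ p ∈ P, ∀ d ∈ D, d ≤ p)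
    (hgap : ∀ d, d ∉ D → ∃ p ∈ P, p ≤ d) : sInf P = sSup D := by
  rcases P.eq_empty_or_nonempty with rfl | hP
  · have : D = univ := eq_univ_of_forall fun d => by
      by_contra h
      simpa using hgap d h
    simp [this]
  rcases D.eq_empty_or_nonempty with rfl | hD
  · rw [Real.sSup_empty, Real.sInf_of_not_bddBelow]
    rintro ⟨b, hb⟩
    obtain ⟨p, hp, hpb⟩ := hgap (b - 1) (by simp)
    linarith [hb hp]
  obtain ⟨p₀, hp₀⟩ := hP
  obtain ⟨d₀, hd₀⟩ := hD
  have hPb : BddBelow P := ⟨d₀, fun p hp => hle p hp d₀ hd₀⟩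
  have hDb : BddAbove D := ⟨p₀, fun d hd => hle p₀ hp₀ d hd⟩
  refine le_antisymm ?_ ?_
  · refine le_of_forall_gt_imp_ge_of_dense fun d hd => ?_
    obtain ⟨p, hp, hpd⟩ := hgap d fun h => absurd (le_csSup hDb h) (not_le.mpr hd)
    exact (csInf_le hPb hp).trans hpd
  · exact csSup_le ⟨d₀, hd₀⟩ fun d hd => le_csInf ⟨p₀, hp₀⟩ fun p hp => hle p hp d hd


/-- strong duality for the shape distance programs, under
compactness, Lipschitz dynamics, continuity of `A` and `c`, and the non-return
assumptions A5' (for the orientation state) and A6' (for the shape image). -/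
theorem shape_strong_duality {nw ns n : ℕ} (T : ℝ) (hT : 0 < T)
    (Om Om0 : Set (Vec nw)) (S : Set (Vec ns)) (X Xu : Set (Vec n))
    (hOm : IsCompact Om) (hOm0 : IsCompact Om0) (hS : IsCompact S)
    (hX : IsCompact X) (hXu : IsCompact Xu) (hOm0Om : Om0 ⊆ Om) (hXuX : Xu ⊆ X)
    (A : Vec ns × Vec nw → Vec n) (hA : Continuous A)
    (hmaps : ∀ s ∈ S, ∀ om ∈ Om, A (s, om) ∈ X)
    (f : ℝ × Vec nw → Vec nw) (K : NNReal) (hf : LipschitzWith K f)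
    (c : Vec n × Vec n → ℝ) (hc : ContinuousOn c (X ×ˢ Xu))
    (hA5 : ∀ om : ℝ → Vec nw, om 0 ∈ Om0 →
      (∀ t ∈ Icc (0 : ℝ) T, HasDerivAt om (f (t, om t)) t) →
      ∀ t ∈ Icc (0 : ℝ) T, om t ∈ frontier Om → ∀ t' ∈ Ioc t T, om t' ∉ Om)
    (hA6 : ∀ om : ℝ → Vec nw, om 0 ∈ Om0 →
      (∀ t ∈ Icc (0 : ℝ) T, HasDerivAt om (f (t, om t)) t) →
      ∀ t ∈ Icc (0 : ℝ) T, ∀ s ∈ S, (A (s, om t) ∉ X ∨ A (s, om t) ∈ frontier X) →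
      ∀ t' ∈ Ioc t T, A (s, om t') ∉ X) :
    sInf {r | ∃ μ0 μp μ μs η, ShapeFeasible T Om Om0 S X Xu A f μ0 μp μ μs η ∧
        r = ∫ p, c p ∂η} =
      sSup {γ | ∃ v w z, ShapeDualFeasible T Om Om0 S X Xu A f c γ v w z} := by
  refine sInf_eq_sSup_of_no_gap ?_ ?_
  · rintro _ ⟨μ0, μp, μ, μs, η, hP, rfl⟩ γ ⟨v, w, z, hD⟩
    exact weak_duality hOm hOm0 hS hX hXu hA hf.continuous hc hP hD
  · intro γ hγ
    obtain ⟨μ0, μp, μ, μs, η, hP, hle⟩ :=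
      exists_shapeFeasible_integral_le hOm hOm0 hS hX hXu hA hf.continuous hc hγ
    exact ⟨_, ⟨μ0, μp, μ, μs, η, hP, rfl⟩, hle⟩
end
end

section
/- Certificate soundness under time-dependent uncertainty: Fix T > 0, compact sets X ⊆ ℝⁿ, X₀ ⊆ X, X_u ⊆ X, a compact uncertainty set H ⊆ ℝ^{N_h}, a continuous f : ℝ × ℝⁿ × ℝ^{N_h} → ℝⁿ, and a continuous cost c on X × X_u. Suppose γ ∈ ℝ, v ∈ C¹([0,T] × X), and w ∈ C(X) satisfy: v(0,x) ≥ γ for all x ∈ X₀; c(x,y) ≥ w(x) for all (x,y) ∈ X × X_u; w(x) ≥ v(t,x) for all (t,x) ∈ [0,T] × X; and ∂_t v(t,x) + f(t,x,h) · ∇_x v(t,x) ≥ 0 for all (t,x,h) ∈ [0,T] × X × H. Then for every measurable uncertainty process h : [0,T] → H and every absolutely continuous trajectory x : [0, t_p] → ℝⁿ with t_p ∈ [0,T], x(0) ∈ X₀, x'(t) = f(t, x(t), h(t)) almost everywhere, and x(t) ∈ X for all t ∈ [0, t_p], and every y ∈ X_u, one has c(x(t_p), y) ≥ γ. -/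
open MeasureTheory Set

noncomputable section

/-- Lie derivative of `v` along the uncertain vector field `f` with uncertainty value
`h`: `∂_t v (t,x) + f (t,x,h) ⬝ ∇ₓ v (t,x)`, expressed as the Fréchet derivative of `v`
at `(t,x)` in the direction `(1, f (t,x,h))`. -/
def LieDU {n nh : ℕ} (f : ℝ × Vec n × Vec nh → Vec n) (v : ℝ × Vec n → ℝ)
    (t : ℝ) (x : Vec n) (h : Vec nh) : ℝ :=
  fderiv ℝ v (t, x) ((1 : ℝ), f (t, x, h))

/-- A bounded integral representation makes a curve Lipschitz. -/
lemma lipschitzOnWith_of_eq_add_integral {E : Type*} [NormedAddCommGroup E] [NormedSpace ℝ E]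
    {x g : ℝ → E} {b : ℝ} {M : NNReal} (hint : IntervalIntegrable g volume 0 b)
    (hx : ∀ t ∈ Icc (0 : ℝ) b, x t = x 0 + ∫ τ in (0 : ℝ)..t, g τ)
    (hM : ∀ t ∈ Icc (0 : ℝ) b, ‖g t‖ ≤ M) : LipschitzOnWith M x (Icc 0 b) := by
  refine LipschitzOnWith.of_dist_le_mul fun s hs t ht => ?_
  have hb : (0 : ℝ) ≤ b := hs.1.trans hs.2
  have hI : ∀ r ∈ Icc (0 : ℝ) b, IntervalIntegrable g volume 0 r := fun r hr =>
    hint.mono_set (by rw [uIcc_of_le hr.1, uIcc_of_le hb]; exact Icc_subset_Icc_right hr.2)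
  rw [dist_eq_norm, hx s hs, hx t ht, add_sub_add_left_eq_sub,
    intervalIntegral.integral_interval_sub_left (hI s hs) (hI t ht), Real.dist_eq]
  refine intervalIntegral.norm_integral_le_of_norm_le_const fun r hr => hM r ?_
  exact uIcc_subset_Icc ht hs (uIoc_subset_uIcc hr)

/-- A Lipschitz function on `[a, b]` with almost everywhere nonnegative derivative does not
decrease from `a` to `b`. -/
lemma LipschitzOnWith.le_of_ae_deriv_nonneg {u : ℝ → ℝ} {a b : ℝ} {K : NNReal}
    (hab : a ≤ b) (hu : LipschitzOnWith K u (Icc a b))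
    (hderiv : ∀ᵐ t ∂(volume.restrict (Icc a b)), 0 ≤ deriv u t) : u a ≤ u b := by
  rw [← uIcc_of_le hab] at hu
  rw [← sub_nonneg, ← hu.absolutelyContinuousOnInterval.integral_deriv_eq_sub]
  exact intervalIntegral.integral_nonneg_of_ae_restrict hab hderiv

/-- certificate soundness under time-dependent uncertainty.  If
`(γ, v, w)` satisfies the uncertain dual constraints (with the Lie derivative
nonnegative for every uncertainty value `h ∈ H`), then along every absolutely
continuous trajectory of `ẋ = f(t, x, h(t))` driven by a measurable process
`h(t) ∈ H`, starting in `X₀` and staying in `X` up to time `t_p ∈ [0,T]`, and for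
every `y ∈ X_u`, one has `c(x(t_p), y) ≥ γ`. -/
theorem uncertain_certificate_soundness {n nh : ℕ} (T : ℝ) (hT : 0 < T)
    (X X0 Xu : Set (Vec n)) (H : Set (Vec nh))
    (hX : IsCompact X) (hX0 : IsCompact X0) (hXu : IsCompact Xu) (hH : IsCompact H)
    (hX0X : X0 ⊆ X) (hXuX : Xu ⊆ X)
    (f : ℝ × Vec n × Vec nh → Vec n) (hf : Continuous f)
    (c : Vec n × Vec n → ℝ) (hc : ContinuousOn c (X ×ˢ Xu))
    (γ : ℝ) (v : ℝ × Vec n → ℝ) (w : Vec n → ℝ)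
    (hv : ContDiff ℝ 1 v) (hw : Continuous w)
    (h1 : ∀ x ∈ X0, γ ≤ v (0, x))
    (h2 : ∀ x ∈ X, ∀ y ∈ Xu, w x ≤ c (x, y))
    (h3 : ∀ t ∈ Icc (0 : ℝ) T, ∀ x ∈ X, v (t, x) ≤ w x)
    (h4 : ∀ t ∈ Icc (0 : ℝ) T, ∀ x ∈ X, ∀ hu ∈ H, 0 ≤ LieDU f v t x hu)
    (h : ℝ → Vec nh) (hmeas : Measurable h) (hH' : ∀ t ∈ Icc (0 : ℝ) T, h t ∈ H)
    (x : ℝ → Vec n) (tp : ℝ) (htp : tp ∈ Icc (0 : ℝ) T)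
    (hx0 : x 0 ∈ X0) (hxX : ∀ t ∈ Icc (0 : ℝ) tp, x t ∈ X)
    (hxc : ContinuousOn x (Icc (0 : ℝ) tp))
    (hint : IntervalIntegrable (fun τ => f (τ, x τ, h τ)) volume 0 tp)
    (hAC : ∀ t ∈ Icc (0 : ℝ) tp, x t = x 0 + ∫ τ in (0 : ℝ)..t, f (τ, x τ, h τ))
    (hderiv : ∀ᵐ t ∂(volume.restrict (Icc (0 : ℝ) tp)),
      HasDerivAt x (f (t, x t, h t)) t)
    (y : Vec n) (hy : y ∈ Xu) :
    γ ≤ c (x tp, y) := by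
  have htpT : Icc (0 : ℝ) tp ⊆ Icc 0 T := Icc_subset_Icc_right htp.2
  obtain ⟨M, hM⟩ := ((isCompact_Icc (a := (0 : ℝ)) (b := T)).prod
    (hX.prod hH)).exists_bound_of_continuousOn hf.continuousOn
  have hxL : LipschitzOnWith M.toNNReal x (Icc 0 tp) :=
    lipschitzOnWith_of_eq_add_integral hint hAC fun t ht =>
      (hM _ ⟨htpT ht, hxX t ht, hH' t (htpT ht)⟩).trans (Real.le_coe_toNNReal M)
  obtain ⟨K, hK⟩ := hv.locallyLipschitz.locallyLipschitzOn.exists_lipschitzOnWith_of_compact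
    ((isCompact_Icc (a := (0 : ℝ)) (b := T)).prod hX)
  have huL := hK.comp ((LipschitzWith.id.lipschitzOnWith (s := Icc 0 tp)).prodMk hxL)
    fun t ht => ⟨htpT ht, hxX t ht⟩
  have hmono := huL.le_of_ae_deriv_nonneg htp.1 (by
    filter_upwards [hderiv, ae_restrict_mem measurableSet_Icc] with t hd ht
    have hc := (hv.differentiable one_ne_zero (t, x t)).hasFDerivAt.comp_hasDerivAt t
      ((hasDerivAt_id t).prodMk hd)
    exact (h4 t (htpT ht) (x t) (hxX t ht) (h t) (hH' t (htpT ht))).trans_eq hc.deriv.symm)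
  have hend : tp ∈ Icc (0 : ℝ) tp := right_mem_Icc.2 htp.1
  calc γ ≤ v (0, x 0) := h1 _ hx0
    _ ≤ v (tp, x tp) := hmono
    _ ≤ w (x tp) := h3 tp htp _ (hxX tp hend)
    _ ≤ c (x tp, y) := h2 _ (hxX tp hend) y hy
end
end
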